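/- Let W be a residually algebraic torsion extension of ℤ_p to ℚ_p(X). Then there exists a pseudo-convergent sequence E = {s_n} ⊂ Q̄_p of transcendental type such that W = ℤ_{p,E} = {φ ∈ ℚ_p(X) : φ(s_n) ∈ Z̄_p for all sufficiently large n}. -/

import Mathlib

open Polynomial Filter

noncomputable section

/-- An additive `ℚ`-valued valuation on a field `K` (written additively, with `v 0 = ⊤`). -/
structure AddVal (K : Type) [Field K] where
  v : K → WithTop ℚ
  v_eq_top_iff : ∀ x : K, v x = ⊤ ↔ x = 0
  v_mul : ∀ x y : K, v (x * y) = v x + v y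
  min_le_v_add : ∀ x y : K, min (v x) (v y) ≤ v (x + y)

namespace AddVal

variable {K : Type} [Field K] (w : AddVal K)

/-- A Cauchy sequence with respect to an additive valuation. -/
def IsCauchySeq (s : ℕ → K) : Prop :=
  ∀ γ : ℚ, ∃ N : ℕ, ∀ m ≥ N, ∀ n ≥ N, (γ : WithTop ℚ) < w.v (s m - s n)

/-- Convergence of a sequence to a limit, with respect to an additive valuation. -/
def TendsToVal (s : ℕ → K) (l : K) : Prop :=
  ∀ γ : ℚ, ∃ N : ℕ, ∀ n ≥ N, (γ : WithTop ℚ) < w.v (s n - l)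

/-- A pseudo-convergent sequence: `v (s n - s m) < v (s m - s k)` for `n < m < k`. -/
def IsPseudoConvergent (s : ℕ → K) : Prop :=
  ∀ ⦃n m k : ℕ⦄, n < m → m < k → w.v (s n - s m) < w.v (s m - s k)

/-- A sequence is of transcendental type over a subring (mapped in via `g`) if for every
polynomial `f` over that ring the sequence `v (f (s n))` is eventually constant. -/
def IsTranscendentalTypeOver {R : Type} [CommRing R] (g : R →+* K) (s : ℕ → K) : Prop :=
  ∀ f : Polynomial R, ∃ N : ℕ, ∀ m ≥ N, ∀ n ≥ N,
    w.v (f.eval₂ g (s m)) = w.v (f.eval₂ g (s n))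

/-- A sequence of transcendental type: for every polynomial `f ∈ K[X]`, `v (f (s n))` is
eventually constant. -/
def IsTranscendentalType (s : ℕ → K) : Prop :=
  w.IsTranscendentalTypeOver (RingHom.id K) s

/-- `α` is a pseudo-limit of `s` when `v (s n - α)` is strictly increasing. -/
def IsPseudoLimit (s : ℕ → K) (α : K) : Prop :=
  StrictMono fun n => w.v (s n - α)

/-- The breadth ideal of a pseudo-convergent sequence. -/
def breadth (s : ℕ → K) : Set K :=
  {x : K | ∀ n : ℕ, w.v (s (n + 1) - s n) < w.v x}

/-- Equivalence of pseudo-convergent sequences. -/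
def SeqEquiv (s t : ℕ → K) : Prop :=
  w.breadth s = w.breadth t ∧
    ∀ k : ℕ, ∃ i₀ j₀ : ℕ, ∀ i ≥ i₀, ∀ j ≥ j₀, w.v (s (k + 1) - s k) < w.v (s i - t j)

end AddVal

/-- `α` is transcendental over the image of `g`. -/
def IsTranscOver {R K : Type} [CommRing R] [Field K] (g : R →+* K) (α : K) : Prop :=
  ∀ f : Polynomial R, f ≠ 0 → f.eval₂ g α ≠ 0
/-- A fixed algebraic closure of `ℚ_p`. -/
abbrev Qpbar (p : ℕ) [Fact p.Prime] : Type := AlgebraicClosure ℚ_[p]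

/-- The unique extension of the `p`-adic valuation to the algebraic closure of `ℚ_p`,
presented as an additive `ℚ`-valued valuation extending `Padic.valuation`. -/
structure PadicSetup (p : ℕ) [Fact p.Prime] where
  vbar : AddVal (Qpbar p)
  vbar_extends : ∀ x : ℚ_[p], x ≠ 0 →
    vbar.v (algebraMap ℚ_[p] (Qpbar p) x) = ((x.valuation : ℚ) : WithTop ℚ)

/-- A model of `ℂ_p`: a complete valued field in which `Q̄_p` embeds isometrically
and densely. -/
structure CpSetup (p : ℕ) [Fact p.Prime] extends PadicSetup p where
  Cp : Type
  [fieldCp : Field Cp]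
  emb : Qpbar p →+* Cp
  vC : AddVal Cp
  vC_emb : ∀ x : Qpbar p, vC.v (emb x) = vbar.v x
  complete : ∀ s : ℕ → Cp, vC.IsCauchySeq s → ∃ l : Cp, vC.TendsToVal s l
  dense : ∀ y : Cp, ∃ s : ℕ → Qpbar p, vC.TendsToVal (fun n => emb (s n)) y

attribute [instance] CpSetup.fieldCp

variable (p : ℕ) [Fact p.Prime]

/-- The degree `[ℚ_p(x) : ℚ_p]` of an element of the algebraic closure of `ℚ_p`. -/
def degOf (x : Qpbar p) : ℕ :=
  Module.finrank ℚ_[p] ↥(IntermediateField.adjoin ℚ_[p] {x})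

/-- A stacked sequence in `Q̄_p`: `s 0 ∈ ℚ_p`, the degrees `[ℚ_p(s n) : ℚ_p]` are strictly
increasing, and each `(s n, v (s (n+1) - s n))` is a minimal pair. -/
structure IsStacked (S : PadicSetup p) (s : ℕ → Qpbar p) : Prop where
  first : ∃ c : ℚ_[p], s 0 = algebraMap ℚ_[p] (Qpbar p) c
  deg_lt : ∀ n : ℕ, degOf p (s n) < degOf p (s (n + 1))
  min_pair : ∀ n : ℕ, ∀ c : Qpbar p, degOf p c < degOf p (s n) →
    S.vbar.v (s n - c) < S.vbar.v (s (n + 1) - s n)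

/-- A strongly stacked sequence: moreover each pair `(s n, s (n+1))` is distinguished. -/
structure IsStronglyStacked (S : PadicSetup p) (s : ℕ → Qpbar p) extends
    IsStacked p S s : Prop where
  dist : ∀ n : ℕ, ∀ c : Qpbar p, degOf p c < degOf p (s (n + 1)) →
    S.vbar.v (s (n + 1) - c) ≤ S.vbar.v (s (n + 1) - s n)

/-- The canonical map `ℚ → Q̄_p`. -/
def qHomQpbar : ℚ →+* Qpbar p :=
  (algebraMap ℚ_[p] (Qpbar p)).comp (Rat.castHom ℚ_[p])

/-- The ring `ℤ_{p,E}` (as a subset of `ℚ_p(X)`) attached to a sequence `E ⊆ Q̄_p`: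
rational functions mapping almost all the `s n` into `Z̄_p`. -/
def ZpE (S : PadicSetup p) (s : ℕ → Qpbar p) : Set (RatFunc ℚ_[p]) :=
  {φ : RatFunc ℚ_[p] | ∀ᶠ n in atTop,
    φ.denom.eval₂ (algebraMap ℚ_[p] (Qpbar p)) (s n) ≠ 0 ∧
      0 ≤ S.vbar.v (φ.eval (algebraMap ℚ_[p] (Qpbar p)) (s n))}

/-- The ring `ℤ_{(p),E}` (as a subset of `ℚ(X)`) attached to a sequence `E ⊆ Q̄_p`. -/
def ZplE (S : PadicSetup p) (s : ℕ → Qpbar p) : Set (RatFunc ℚ) :=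
  {φ : RatFunc ℚ | ∀ᶠ n in atTop,
    φ.denom.eval₂ (qHomQpbar p) (s n) ≠ 0 ∧
      0 ≤ S.vbar.v (φ.eval (qHomQpbar p) (s n))}

/-- `W` is a residually algebraic torsion extension of `ℤ_p` to `ℚ_p(X)`:
`W ∩ ℚ_p = ℤ_p`, the residue field of `W` is algebraic over `𝔽_p`, and the value group of `W`
is contained in the divisible hull of the value group of `ℤ_p`. -/
def IsResAlgTorsionQp (W : ValuationSubring (RatFunc ℚ_[p])) : Prop :=
  (∀ c : ℚ_[p], RatFunc.C c ∈ W ↔ ‖c‖ ≤ 1) ∧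
  (∀ x : IsLocalRing.ResidueField W, ∃ k : ℕ, 1 ≤ k ∧ x ^ p ^ k = x) ∧
  (∀ φ : RatFunc ℚ_[p], φ ≠ 0 → ∃ n : ℕ, 1 ≤ n ∧ ∃ c : ℚ_[p], c ≠ 0 ∧
    φ ^ n / RatFunc.C c ∈ W ∧ RatFunc.C c / φ ^ n ∈ W)

/-- `W` is a residually algebraic torsion extension of `ℤ_(p)` to `ℚ(X)`. -/
def IsResAlgTorsionQ (W : ValuationSubring (RatFunc ℚ)) : Prop :=
  (∀ c : ℚ, RatFunc.C c ∈ W ↔ ‖(c : ℚ_[p])‖ ≤ 1) ∧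
  (∀ x : IsLocalRing.ResidueField W, ∃ k : ℕ, 1 ≤ k ∧ x ^ p ^ k = x) ∧
  (∀ φ : RatFunc ℚ, φ ≠ 0 → ∃ n : ℕ, 1 ≤ n ∧ ∃ c : ℚ, c ≠ 0 ∧
    φ ^ n / RatFunc.C c ∈ W ∧ RatFunc.C c / φ ^ n ∈ W)

/-- The set of (rational) values of the valuation on an intermediate field of `Q̄_p/ℚ_p`. -/
def valSetF (S : PadicSetup p) (F : IntermediateField ℚ_[p] (Qpbar p)) : Set ℚ :=
  {γ : ℚ | ∃ a ∈ F, S.vbar.v a = (γ : WithTop ℚ)}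

/-- The value group (as a set of rationals) of `ℚ_p(x)` for `x ∈ Q̄_p`. -/
def valSetElem (S : PadicSetup p) (x : Qpbar p) : Set ℚ :=
  valSetF p S (IntermediateField.adjoin ℚ_[p] {x})

/-- The residue field of `F` is contained in the residue field of `F'` (inside the residue
field of `Z̄_p`). -/
def resSub (S : PadicSetup p) (F F' : IntermediateField ℚ_[p] (Qpbar p)) : Prop :=
  ∀ a ∈ F, 0 ≤ S.vbar.v a → ∃ b ∈ F', 0 ≤ S.vbar.v b ∧ 0 < S.vbar.v (a - b)

/-- A subset `Γ ⊆ ℚ` (a value group) has bounded denominators, i.e. finite ramification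
over `ℤ`. -/
def HasFiniteRamification (Γ : Set ℚ) : Prop :=
  ∃ e : ℕ, 0 < e ∧ ∀ γ ∈ Γ, ∃ k : ℤ, (e : ℚ) * γ = (k : ℚ)

/-- The ramification index of `Γ₁` over `Γ₀`: the least positive integer `e` with
`e • Γ₁ ⊆ Γ₀` (for the value groups of finite extensions of `ℚ_p` this is the index
`[Γ₁ : Γ₀]`). -/
def ramIdx (Γ₀ Γ₁ : Set ℚ) : ℕ :=
  sInf {e : ℕ | 0 < e ∧ ∀ γ ∈ Γ₁, (e : ℚ) * γ ∈ Γ₀}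

/-- The value group of `ℚ_p` (normalized): the integers, as a subset of `ℚ`. -/
def zSet : Set ℚ := Set.range ((↑) : ℤ → ℚ)

/-- The maximal unramified extension of a finite extension `K` of `ℚ_p` inside `Q̄_p`:
the set of `x` with `K(x)/K` unramified. -/
def maxUnramified (S : PadicSetup p) (K : IntermediateField ℚ_[p] (Qpbar p)) :
    Set (Qpbar p) :=
  {x : Qpbar p | valSetF p S (K ⊔ IntermediateField.adjoin ℚ_[p] {x}) = valSetF p S K}

section CpDefs

variable (S : CpSetup p)

/-- The canonical map `ℚ_p → ℂ_p`. -/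
def qpHomC : ℚ_[p] →+* S.Cp :=
  S.emb.comp (algebraMap ℚ_[p] (Qpbar p))

/-- The canonical map `ℚ → ℂ_p`. -/
def qHomC : ℚ →+* S.Cp :=
  (qpHomC p S).comp (Rat.castHom ℚ_[p])

/-- The valuation domain `ℤ_{p,α} = {φ ∈ ℚ_p(X) : φ(α) ∈ O_p}` (as a subset of `ℚ_p(X)`). -/
def Zpa (α : S.Cp) : Set (RatFunc ℚ_[p]) :=
  {φ : RatFunc ℚ_[p] | φ.denom.eval₂ (qpHomC p S) α ≠ 0 ∧
    0 ≤ S.vC.v (φ.eval (qpHomC p S) α)}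

/-- The valuation domain `ℤ_{(p),α} = {φ ∈ ℚ(X) : φ(α) ∈ O_p}` (as a subset of `ℚ(X)`). -/
def Zpla (α : S.Cp) : Set (RatFunc ℚ) :=
  {φ : RatFunc ℚ | φ.denom.eval₂ (qHomC p S) α ≠ 0 ∧
    0 ≤ S.vC.v (φ.eval (qHomC p S) α)}

/-- Membership in the subfield `ℚ_p(α)` of `ℂ_p`. -/
def InQpAlpha (α x : S.Cp) : Prop :=
  ∃ f g : Polynomial ℚ_[p], g.eval₂ (qpHomC p S) α ≠ 0 ∧
    x = f.eval₂ (qpHomC p S) α / g.eval₂ (qpHomC p S) α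

/-- The value group `Γ_α ⊆ ℚ` of `ℚ_p(α) ⊆ ℂ_p`. -/
def valSetCp (α : S.Cp) : Set ℚ :=
  {γ : ℚ | ∃ x : S.Cp, InQpAlpha p S α x ∧ S.vC.v x = (γ : WithTop ℚ)}

/-- The residue field `k_α` of `O_{p,α} = O_p ∩ ℚ_p(α)` is finite. -/
def ResFieldFiniteCp (α : S.Cp) : Prop :=
  ∃ T : Finset S.Cp, ∀ x : S.Cp, InQpAlpha p S α x → 0 ≤ S.vC.v x →
    ∃ a ∈ T, 0 < S.vC.v (x - a)

/-- `α` and `β` are conjugate over `ℚ_p`: some element of `Gal(Q̄_p/ℚ_p)`, extended to its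
unique continuous (equivalently, isometric) automorphism of `ℂ_p`, maps `α` to `β`. -/
def ConjCp (α β : S.Cp) : Prop :=
  ∃ σ : S.Cp →+* S.Cp, (∀ c : ℚ_[p], σ (qpHomC p S c) = qpHomC p S c) ∧
    (∀ x : Qpbar p, ∃ y : Qpbar p, σ (S.emb x) = S.emb y) ∧
    (∀ x : S.Cp, S.vC.v (σ x) = S.vC.v x) ∧ σ α = β

end CpDefs

namespace AddVal

variable {K : Type} [Field K] (w : AddVal K)

theorem v_zero : w.v 0 = ⊤ := (w.v_eq_top_iff 0).2 rfl

theorem exists_v_eq_coe {x : K} (hx : x ≠ 0) : ∃ q : ℚ, w.v x = q := by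
  obtain ⟨q, hq⟩ := WithTop.ne_top_iff_exists.1 (mt (w.v_eq_top_iff x).1 hx)
  exact ⟨q, hq.symm⟩

theorem v_one : w.v 1 = 0 := by
  obtain ⟨q, hq⟩ := w.exists_v_eq_coe (one_ne_zero (α := K))
  have h := w.v_mul 1 1
  rw [mul_one, hq] at h
  rw [hq]
  norm_cast at h ⊢
  linarith

theorem v_pow (x : K) (n : ℕ) : w.v (x ^ n) = n • w.v x := by
  induction n with
  | zero => simp [w.v_one]
  | succ n ih => rw [pow_succ, w.v_mul, ih, succ_nsmul]

theorem v_div_add {x y : K} (hy : y ≠ 0) : w.v (x / y) + w.v y = w.v x := by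
  rw [← w.v_mul, div_mul_cancel₀ x hy]

theorem zero_le_v_div_iff {x y : K} (hy : y ≠ 0) : 0 ≤ w.v (x / y) ↔ w.v y ≤ w.v x := by
  obtain ⟨q, hq⟩ := w.exists_v_eq_coe hy
  rw [← w.v_div_add (x := x) hy, hq]
  cases w.v (x / y) with
  | top => simp
  | coe r =>
    norm_cast
    exact ⟨fun h => by linarith, fun h => by linarith⟩

open scoped Classical in
/-- The real-valued absolute value `x ↦ b ^ (-w x)`. -/
def toAbsoluteValue (b : ℝ) (hb : 1 < b) : AbsoluteValue K ℝ where
  toFun x := if x = 0 then 0 else b ^ (-(((w.v x).untopD 0 : ℚ) : ℝ))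
  map_mul' x y := by
    by_cases hx : x = 0
    · simp [hx]
    by_cases hy : y = 0
    · simp [hy]
    obtain ⟨q, hq⟩ := w.exists_v_eq_coe hx
    obtain ⟨r, hr⟩ := w.exists_v_eq_coe hy
    have h : w.v (x * y) = ((q + r : ℚ) : WithTop ℚ) := by rw [w.v_mul, hq, hr]; rfl
    simp only [mul_eq_zero, hx, hy, or_self, if_false, hq, hr, h, WithTop.untopD_coe]
    rw [← Real.rpow_add (by linarith)]
    push_cast
    ring_nf
  nonneg' x := by
    split_ifs
    · rfl
    · positivity
  eq_zero' x := by
    refine ⟨fun h => ?_, fun h => by simp [h]⟩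
    by_contra hx
    rw [if_neg hx] at h
    exact (Real.rpow_pos_of_pos (by linarith) _).ne' h
  add_le' x y := by
    by_cases hx : x = 0
    · simp [hx]
    by_cases hy : y = 0
    · simp [hy]
    by_cases hxy : x + y = 0
    · simp only [hxy, if_true]
      positivity
    obtain ⟨q, hq⟩ := w.exists_v_eq_coe hx
    obtain ⟨r, hr⟩ := w.exists_v_eq_coe hy
    obtain ⟨t, ht⟩ := w.exists_v_eq_coe hxy
    have h := w.min_le_v_add x y
    simp only [hx, hy, hxy, if_false, hq, hr, ht, WithTop.untopD_coe] at h ⊢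
    have hpos : ∀ z : ℝ, 0 < b ^ z := fun z => Real.rpow_pos_of_pos (by linarith) z
    rcases min_le_iff.1 h with h | h
    · have h' : (q : ℝ) ≤ t := by exact_mod_cast h
      have := Real.rpow_le_rpow_of_exponent_le hb.le (neg_le_neg h')
      linarith [hpos (-(r : ℝ))]
    · have h' : (r : ℝ) ≤ t := by exact_mod_cast h
      have := Real.rpow_le_rpow_of_exponent_le hb.le (neg_le_neg h')
      linarith [hpos (-(q : ℝ))]

theorem toAbsoluteValue_apply {b : ℝ} (hb : 1 < b) {x : K} {q : ℚ} (hq : w.v x = q) :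
    w.toAbsoluteValue b hb x = b ^ (-(q : ℝ)) := by
  have hx : x ≠ 0 := fun h => by simp [h, w.v_zero] at hq
  exact (if_neg hx).trans (by rw [hq, WithTop.untopD_coe])

end AddVal

theorem PadicSetup.norm_coeff_minpoly_le_one {p : ℕ} [Fact p.Prime] (S : PadicSetup p)
    {x : Qpbar p} (hx : 0 ≤ S.vbar.v x) (n : ℕ) : ‖(minpoly ℚ_[p] x).coeff n‖ ≤ 1 := by
  have hp : (1 : ℝ) < p := by exact_mod_cast (Fact.out : p.Prime).one_lt
  have hext : ∀ c : ℚ_[p],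
      S.vbar.toAbsoluteValue p hp (algebraMap ℚ_[p] (Qpbar p) c) = ‖c‖ := by
    intro c
    by_cases hc : c = 0
    · simp [hc]
    rw [S.vbar.toAbsoluteValue_apply hp (S.vbar_extends c hc),
      Padic.norm_eq_zpow_neg_valuation hc, ← Real.rpow_intCast]
    simp
  have h := spectralNorm_unique_field_norm_ext hext x
  have hle : S.vbar.toAbsoluteValue p hp x ≤ 1 := by
    by_cases h0 : x = 0
    · simp [h0]
    obtain ⟨q, hq⟩ := S.vbar.exists_v_eq_coe h0
    rw [S.vbar.toAbsoluteValue_apply hp hq]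
    rw [hq] at hx
    have hq0 : (0 : ℝ) ≤ q := by exact_mod_cast hx
    exact Real.rpow_le_one_of_one_le_of_nonpos hp.le (by simpa using hq0)
  rw [h] at hle
  exact (spectralValue_le_one_iff (minpoly.monic (Algebra.IsIntegral.isIntegral x))).1 hle n

section Sequence

variable {K Ω Γ : Type} [Field K] [Field Ω] [LinearOrderedCommGroupWithZero Γ]
  (w : AddVal K) (ι : K →+* Ω) (v : Valuation Ω Γ)

/-- If no `x - ι a` has minimal valuation, then `x` is approximated by a sequence from `K`
whose distances to `x` are eventually smaller than any `v (x - ι b)`. -/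
theorem exists_seq_strictAnti_approx (hle : ∀ a b, w.v a ≤ w.v b ↔ v (ι b) ≤ v (ι a)) (x : Ω)
    (hx : ∀ a, ∃ b, v (x - ι b) < v (x - ι a)) :
    ∃ s : ℕ → K, StrictAnti (fun n => v (x - ι (s n))) ∧
      ∀ b, ∀ᶠ n in atTop, v (x - ι (s n)) < v (x - ι b) := by
  have hval : ∀ a, ∃ c, v (x - ι a) = v (ι c) := by
    intro a
    obtain ⟨b, hb⟩ := hx a
    refine ⟨b - a, ?_⟩
    rw [ι.map_sub, show ι b - ι a = (x - ι a) - (x - ι b) by ring, v.map_sub_eq_of_lt_left hb]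
  choose c hc using hval
  have hfac : (fun a => v (ι a)).FactorsThrough w.v := fun a b hab =>
    le_antisymm ((hle b a).1 hab.ge) ((hle a b).1 hab.le)
  obtain ⟨e, he⟩ := (Function.factorsThrough_iff _).1 hfac
  have hcount : (Set.range fun a => v (x - ι a)).Countable := by
    refine (Set.countable_range e).mono ?_
    rintro _ ⟨a, rfl⟩
    exact ⟨w.v (c a), (congrFun he (c a)).symm.trans (hc a).symm⟩
  obtain ⟨d, hd⟩ := hcount.exists_eq_range (Set.range_nonempty _)
  have hstep : ∀ (n : ℕ) (a : K), ∃ b, v (x - ι b) < v (x - ι a) ∧ v (x - ι b) < d n := by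
    intro n a
    obtain ⟨e, he⟩ : d n ∈ Set.range fun a => v (x - ι a) := hd ▸ Set.mem_range_self n
    rw [← he]
    rcases le_total (v (x - ι a)) (v (x - ι e)) with h | h
    · obtain ⟨b, hb⟩ := hx a
      exact ⟨b, hb, hb.trans_le h⟩
    · obtain ⟨b, hb⟩ := hx e
      exact ⟨b, hb.trans_le h, hb⟩
  choose t ht₁ ht₂ using hstep
  let s : ℕ → K := fun n => Nat.rec 0 t n
  have hs : StrictAnti (fun n => v (x - ι (s n))) := strictAnti_nat_of_succ_lt fun n => ht₁ n (s n)
  refine ⟨s, hs, fun b => ?_⟩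
  obtain ⟨n, hn⟩ : v (x - ι b) ∈ Set.range d := hd ▸ Set.mem_range_self b
  filter_upwards [eventually_ge_atTop (n + 1)] with m hm
  rw [← hn]
  exact (hs.antitone hm).trans_lt (ht₂ n (s n))

variable {w ι v}

theorem isPseudoConvergent_of_strictAnti (hle : ∀ a b, w.v a ≤ w.v b ↔ v (ι b) ≤ v (ι a)) {x : Ω}
    {s : ℕ → K} (hs : StrictAnti (fun n => v (x - ι (s n)))) : w.IsPseudoConvergent s := by
  have key : ∀ n m, n < m → v (ι (s n - s m)) = v (x - ι (s n)) := by
    intro n m h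
    rw [map_sub, v.map_sub_swap, show ι (s m) - ι (s n) = (x - ι (s n)) - (x - ι (s m)) by ring,
      v.map_sub_eq_of_lt_left (hs h)]
  intro n m k hnm hmk
  rw [← not_le, hle, not_le, key n m hnm, key m k hmk]
  exact hs hnm

theorem eventually_valuation_eval_eq [IsAlgClosed K] {x : Ω} {s : ℕ → K}
    (hs : ∀ b, ∀ᶠ n in atTop, v (x - ι (s n)) < v (x - ι b)) (f : K[X]) :
    ∀ᶠ n in atTop, v (ι (f.eval (s n))) = v (f.eval₂ ι x) := by
  have hf : f ∈ Submonoid.closure ({C a | a : K} ∪ {X + C a | a : K}) := IsAlgClosed.splits f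
  induction hf using Submonoid.closure_induction with
  | mem f hf =>
    rcases hf with ⟨a, rfl⟩ | ⟨a, rfl⟩
    · simp
    · filter_upwards [hs (-a)] with n hn
      rw [map_neg, sub_neg_eq_add] at hn
      rw [eval_add, eval_X, eval_C, eval₂_add, eval₂_X, eval₂_C, map_add,
        show ι (s n) + ι a = (x + ι a) - (x - ι (s n)) by ring, v.map_sub_eq_of_lt_left hn]
  | one => simp
  | mul f g _ _ hf hg =>
    filter_upwards [hf, hg] with n hf hg
    rw [eval_mul, map_mul, map_mul, eval₂_mul, map_mul, hf, hg]

end Sequence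

theorem PadicSetup.vbar_le_iff {p : ℕ} [Fact p.Prime] (S : PadicSetup p) {Ω Γ : Type} [Field Ω]
    [LinearOrderedCommGroupWithZero Γ] {v : Valuation Ω Γ} {ι : Qpbar p →+* Ω}
    (hv : ∀ c : ℚ_[p], v (ι (algebraMap ℚ_[p] (Qpbar p) c)) ≤ 1 ↔ ‖c‖ ≤ 1) (a b : Qpbar p) :
    S.vbar.v a ≤ S.vbar.v b ↔ v (ι b) ≤ v (ι a) := by
  have hint : ∀ x, 0 ≤ S.vbar.v x → v (ι x) ≤ 1 := by
    intro x hx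
    have hmon : (minpoly ℚ_[p] x).Monic := minpoly.monic (Algebra.IsIntegral.isIntegral x)
    have hsum : ι (aeval x (minpoly ℚ_[p] x)) = 0 := by rw [minpoly.aeval, map_zero]
    have hdeg : (minpoly ℚ_[p] x).natDegree ≠ 0 :=
      (minpoly.natDegree_pos (Algebra.IsIntegral.isIntegral x)).ne'
    rw [aeval_eq_sum_range, Finset.sum_range_succ, hmon.coeff_natDegree, one_smul, map_add,
      map_sum, add_eq_zero_iff_eq_neg] at hsum
    by_contra! h
    refine ne_of_lt (v.map_sum_lt ?_ ?_) ((congrArg v hsum).trans (v.map_neg _))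
    · rw [map_pow, map_pow]
      exact pow_ne_zero _ (zero_lt_one.trans h).ne'
    · intro i hi
      rw [Algebra.smul_def, map_mul, map_mul, map_pow, map_pow, map_pow, map_pow]
      exact mul_lt_of_le_one_of_lt ((hv _).2 (S.norm_coeff_minpoly_le_one hx i))
        (pow_lt_pow_right₀ h (Finset.mem_range.1 hi))
  have hiff : ∀ x, 0 ≤ S.vbar.v x ↔ v (ι x) ≤ 1 := by
    refine fun x => ⟨hint x, fun hx => ?_⟩
    by_contra! hneg
    have hx0 : x ≠ 0 := fun h => by simp [h, S.vbar.v_zero] at hneg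
    obtain ⟨q, hq⟩ := S.vbar.exists_v_eq_coe hx0
    have hq0 : q < 0 := by rw [hq] at hneg; exact_mod_cast hneg
    obtain ⟨n, hn⟩ := exists_nat_ge (-q)⁻¹
    have hp0 : (p : ℚ_[p]) ≠ 0 := by exact_mod_cast (Fact.out : p.Prime).ne_zero
    have hvp : S.vbar.v (algebraMap ℚ_[p] (Qpbar p) (p : ℚ_[p])⁻¹) = ((-1 : ℚ) : WithTop ℚ) := by
      rw [S.vbar_extends _ (inv_ne_zero hp0)]
      simp
    have h1 : v (ι (algebraMap ℚ_[p] (Qpbar p) (p : ℚ_[p])⁻¹ / x ^ n)) ≤ 1 := by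
      refine hint _ ((S.vbar.zero_le_v_div_iff (pow_ne_zero n hx0)).2 ?_)
      rw [hvp, S.vbar.v_pow, hq, ← WithTop.coe_nsmul, WithTop.coe_le_coe, nsmul_eq_mul]
      have := mul_le_mul_of_nonneg_right hn (neg_pos.2 hq0).le
      rw [inv_mul_cancel₀ (neg_pos.2 hq0).ne'] at this
      linarith
    have h2 : v (ι (algebraMap ℚ_[p] (Qpbar p) (p : ℚ_[p])⁻¹)) ≤ 1 := by
      rw [← div_mul_cancel₀ (algebraMap ℚ_[p] (Qpbar p) (p : ℚ_[p])⁻¹) (pow_ne_zero n hx0),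
        map_mul, map_mul, map_pow, map_pow]
      exact mul_le_one' h1 (pow_le_one' hx n)
    rw [hv, norm_inv, inv_le_one₀ (norm_pos_iff.2 hp0)] at h2
    exact h2.not_gt Padic.norm_p_lt_one
  by_cases ha : a = 0
  · subst ha
    rw [S.vbar.v_zero, top_le_iff, S.vbar.v_eq_top_iff, map_zero, map_zero, le_zero_iff,
      v.zero_iff, map_eq_zero]
  · have hva : v (ι a) ≠ 0 := by simpa using ha
    rw [← S.vbar.zero_le_v_div_iff ha, hiff, map_div₀, map_div₀, div_le_one₀ (zero_lt_iff.2 hva)]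

namespace Valuation

variable {F Ω Γ : Type} [Field F] [Field Ω] [Algebra F Ω] [LinearOrderedCommGroupWithZero Γ]
  (v : Valuation Ω Γ)

theorem exists_eq_of_sum_eq_zero {α : Type} [DecidableEq α] {s : Finset α} {f : α → Ω}
    (hs : s.Nonempty) (hf : ∀ i ∈ s, f i ≠ 0) (h : ∑ i ∈ s, f i = 0) :
    ∃ i ∈ s, ∃ j ∈ s, i ≠ j ∧ v (f i) = v (f j) := by
  obtain ⟨j, hj, hmax⟩ := s.exists_max_image (fun i => v (f i)) hs
  by_contra! hne
  have := v.map_sum_eq_of_lt hj fun i hi => by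
    obtain ⟨hi, hij⟩ := Finset.mem_sdiff.1 hi
    exact lt_of_le_of_ne (hmax i hi) (hne i hi j hj (by simpa using hij))
  rw [h, map_zero] at this
  exact hf j hj (v.zero_iff.1 this.symm)

/-- The value group of an algebraic extension is torsion over that of the base field. -/
theorem exists_pow_eq_of_isAlgebraic {z : Ω} (hz : IsAlgebraic F z) (hz0 : z ≠ 0) :
    ∃ n : ℕ, 1 ≤ n ∧ ∃ φ : F, φ ≠ 0 ∧ v (z ^ n) = v (algebraMap F Ω φ) := by
  obtain ⟨q, hq0, hq⟩ := hz
  rw [aeval_def, eval₂_eq_sum, sum_def] at hq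
  have hcoeff : ∀ i ∈ q.support, algebraMap F Ω (q.coeff i) ≠ 0 := fun i hi => by
    simpa using mem_support_iff.1 hi
  obtain ⟨i, hi, j, hj, hij, h⟩ := v.exists_eq_of_sum_eq_zero (nonempty_support_iff.2 hq0)
    (fun i hi => mul_ne_zero (hcoeff i hi) (pow_ne_zero i hz0)) hq
  wlog hlt : i < j generalizing i j
  · exact this j hj i hi hij.symm h.symm (lt_of_le_of_ne (not_lt.1 hlt) hij.symm)
  obtain ⟨n, rfl⟩ : ∃ n, j = n + i := ⟨j - i, by omega⟩
  refine ⟨n, by omega, q.coeff i / q.coeff (n + i),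
    div_ne_zero (mem_support_iff.1 hi) (mem_support_iff.1 hj), ?_⟩
  have hz0' : v (z ^ i) ≠ 0 := by simpa using fun h => absurd h hz0
  have hj0 : v (algebraMap F Ω (q.coeff (n + i))) ≠ 0 := (v.ne_zero_iff).2 (hcoeff _ hj)
  rw [pow_add, ← mul_assoc, map_mul, map_mul v _ (z ^ i)] at h
  rw [map_div₀, map_div₀, eq_div_iff hj0, mul_comm, ← map_mul]
  exact (mul_right_cancel₀ hz0' h).symm

end Valuation

open IsLocalRing in
/-- The residue field of an algebraic extension of valuation rings is algebraic. -/
theorem ValuationSubring.isAlgebraic_residue {F Ω : Type} [Field F] [Field Ω] [Algebra F Ω]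
    {W : ValuationSubring F} {B : ValuationSubring Ω} (g : W →+* B) [IsLocalHom g]
    (hg : ∀ a : W, (g a : Ω) = algebraMap F Ω a) {z : B} (hz : IsAlgebraic F (z : Ω)) :
    ∃ q : (ResidueField W)[X], q ≠ 0 ∧ q.eval₂ (ResidueField.map g) (residue B z) = 0 := by
  obtain ⟨q, hq0, hq⟩ := hz
  obtain ⟨j, hj, hmax⟩ := q.support.exists_max_image (fun i => W.valuation (q.coeff i))
    (nonempty_support_iff.2 hq0)
  have hj0 : q.coeff j ≠ 0 := mem_support_iff.1 hj
  have hmem : ∀ i, q.coeff i / q.coeff j ∈ W := by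
    intro i
    rw [← W.valuation_le_one_iff, map_div₀, div_le_one₀ (zero_lt_iff.2 (by simpa using hj0))]
    by_cases hi : i ∈ q.support
    · exact hmax i hi
    · simp [notMem_support_iff.1 hi]
  have hlift : C (q.coeff j)⁻¹ * q ∈ lifts W.subtype := by
    rw [lifts_iff_coeff_lifts]
    intro i
    exact ⟨⟨_, hmem i⟩, by simp [div_eq_inv_mul]⟩
  obtain ⟨Q, hQ⟩ := (mem_lifts _).1 hlift
  have hQj : Q.coeff j = 1 := by
    have := congrArg (fun r => coeff r j) hQ
    simp only [coeff_map, coeff_C_mul, inv_mul_cancel₀ hj0] at this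
    exact Subtype.ext this
  refine ⟨Q.map (residue W), fun h => ?_, ?_⟩
  · have := congrArg (fun r => coeff r j) h
    simp [hQj] at this
  · have hz : Q.eval₂ g z = 0 := by
      apply B.subtype_injective
      have hcomp : B.subtype.comp g = (algebraMap F Ω).comp W.subtype := RingHom.ext hg
      rw [hom_eval₂, hcomp, map_zero, ← eval₂_map, hQ, eval₂_mul]
      exact mul_eq_zero_of_right _ hq
    rw [eval₂_map, show (ResidueField.map g).comp (residue W) = (residue B).comp g from
      RingHom.ext fun a => ResidueField.map_residue g a, ← hom_eval₂, hz, map_zero]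

open IsLocalRing in
/-- An element of a valuation ring `B` whose residue is integral over `ℤ` is congruent to an
element of any algebraically closed subfield. -/
theorem ValuationSubring.exists_valuation_sub_lt_one {K Ω : Type} [Field K] [IsAlgClosed K]
    [Field Ω] (ι : K →+* Ω) {B : ValuationSubring Ω} {z : B}
    (hz : IsIntegral ℤ (residue B z)) : ∃ d, B.valuation (z - ι d) < 1 := by
  obtain ⟨P, hP, hPz⟩ := hz
  have hlt : B.valuation (P.eval₂ (Int.castRingHom Ω) (z : Ω)) < 1 := by
    rw [show (algebraMap ℤ (ResidueField B)) = (residue B).comp (Int.castRingHom B) from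
      RingHom.ext_int _ _, ← hom_eval₂, residue_eq_zero_iff, B.valuation_lt_one_iff] at hPz
    rwa [show Int.castRingHom Ω = B.subtype.comp (Int.castRingHom B) from RingHom.ext_int _ _,
      show (z : Ω) = B.subtype z from rfl, ← hom_eval₂]
  by_contra! hge
  refine hlt.not_ge ?_
  have hsplit := (IsAlgClosed.splits (P.map (Int.castRingHom K))).eq_prod_roots_of_monic (hP.map _)
  rw [show Int.castRingHom Ω = ι.comp (Int.castRingHom K) from RingHom.ext_int _ _, ← eval₂_map,
    hsplit, eval₂_multiset_prod, map_multiset_prod]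
  refine Multiset.one_le_prod_of_one_le ?_
  simpa using fun _ a _ _ h => h ▸ hge a

open IsLocalRing in
theorem exists_extension_of_isResAlgTorsionQp {p : ℕ} [Fact p.Prime]
    {W : ValuationSubring (RatFunc ℚ_[p])} (hW : IsResAlgTorsionQp p W)
    {Ω : Type} [Field Ω] [Algebra (RatFunc ℚ_[p]) Ω] [Algebra.IsAlgebraic (RatFunc ℚ_[p]) Ω] :
    ∃ B : ValuationSubring Ω, (∀ φ, B.valuation (algebraMap (RatFunc ℚ_[p]) Ω φ) ≤ 1 ↔ φ ∈ W) ∧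
      ∀ z : B, IsIntegral ℤ (residue B z) := by
  obtain ⟨B, hB, hloc⟩ := IsLocalRing.exists_factor_valuationRing
    ((algebraMap (RatFunc ℚ_[p]) Ω).comp W.subtype)
  let g : W →+* B := RingHom.codRestrict _ B.toSubring hB
  have : IsLocalHom g := hloc
  refine ⟨B, fun φ => ⟨fun h => ?_, fun h => B.valuation_le_one (g ⟨φ, h⟩)⟩, fun z => ?_⟩
  · rw [B.valuation_le_one_iff] at h
    by_contra hφ
    have hφ0 : φ ≠ 0 := fun h0 => hφ (h0 ▸ W.zero_mem)
    have hinv : φ⁻¹ ∈ W := (W.mem_or_inv_mem φ).resolve_left hφ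
    have hunit : IsUnit (g ⟨φ⁻¹, hinv⟩) := by
      refine IsUnit.of_mul_eq_one ⟨_, h⟩ (Subtype.ext ?_)
      change algebraMap _ Ω φ⁻¹ * algebraMap _ Ω φ = 1
      rw [← map_mul, inv_mul_cancel₀ hφ0, map_one]
    obtain ⟨b, hb⟩ := (isUnit_of_map_unit g _ hunit).exists_right_inv
    have hb' : φ⁻¹ * b = 1 := congrArg Subtype.val hb
    rw [inv_mul_eq_one₀ hφ0] at hb'
    exact hφ (hb' ▸ b.2)
  · obtain ⟨q, hq0, hq⟩ := ValuationSubring.isAlgebraic_residue g (fun _ => rfl)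
      (Algebra.IsAlgebraic.isAlgebraic (R := RatFunc ℚ_[p]) (z : Ω))
    let : Algebra (ResidueField W) (ResidueField B) := (ResidueField.map g).toAlgebra
    have := IsScalarTower.of_algebraMap_eq' (R := ℤ) (S := ResidueField W) (A := ResidueField B)
      (RingHom.ext_int _ _)
    have hint : Algebra.IsIntegral ℤ (ResidueField W) := ⟨fun x => by
      obtain ⟨k, hk, hx⟩ := hW.2.1 x
      have hpk : 1 < p ^ k := Nat.one_lt_pow (by omega) (Fact.out : p.Prime).one_lt
      refine ⟨X ^ p ^ k - X, monic_X_pow_sub (by rw [degree_X]; exact_mod_cast hpk), ?_⟩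
      simp [hx]⟩
    exact isIntegral_trans (A := ResidueField W) _ (IsAlgebraic.isIntegral ⟨q, hq0, hq⟩)

/-- A valuation extending a torsion extension takes on `Ω` only values of the algebraically
closed field `Q̄_p`. -/
theorem exists_valuation_eq_of_isResAlgTorsionQp {p : ℕ} [Fact p.Prime]
    {W : ValuationSubring (RatFunc ℚ_[p])} (hW : IsResAlgTorsionQp p W)
    {Ω Γ : Type} [Field Ω] [Algebra (RatFunc ℚ_[p]) Ω] [Algebra.IsAlgebraic (RatFunc ℚ_[p]) Ω]
    [LinearOrderedCommGroupWithZero Γ] {v : Valuation Ω Γ}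
    (hv : ∀ φ, v (algebraMap (RatFunc ℚ_[p]) Ω φ) ≤ 1 ↔ φ ∈ W) {ι : Qpbar p →+* Ω}
    (hι : ∀ c, ι (algebraMap ℚ_[p] (Qpbar p) c) = algebraMap (RatFunc ℚ_[p]) Ω (RatFunc.C c))
    (z : Ω) : ∃ c, v z = v (ι c) := by
  by_cases hz : z = 0
  · exact ⟨0, by simp [hz]⟩
  obtain ⟨n, hn, φ, hφ, hzφ⟩ := v.exists_pow_eq_of_isAlgebraic
    (Algebra.IsAlgebraic.isAlgebraic (R := RatFunc ℚ_[p]) z) hz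
  obtain ⟨m, hm, c, hc, h₁, h₂⟩ := hW.2.2 φ hφ
  have hmn : 0 < n * m := Nat.mul_pos hn hm
  obtain ⟨d, hd⟩ := IsAlgClosed.exists_pow_nat_eq (algebraMap ℚ_[p] (Qpbar p) c) hmn
  refine ⟨d, ?_⟩
  have hCc : v (algebraMap (RatFunc ℚ_[p]) Ω (RatFunc.C c)) ≠ 0 := by simpa using hc
  have hφm : v (algebraMap (RatFunc ℚ_[p]) Ω φ) ^ m ≠ 0 := pow_ne_zero _ (by simpa using hφ)
  have h : v (algebraMap (RatFunc ℚ_[p]) Ω φ) ^ m =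
      v (algebraMap (RatFunc ℚ_[p]) Ω (RatFunc.C c)) := by
    rw [← hv, map_div₀, map_div₀, map_pow, map_pow] at h₁ h₂
    exact le_antisymm ((div_le_one₀ (zero_lt_iff.2 hCc)).1 h₁)
      ((div_le_one₀ (zero_lt_iff.2 hφm)).1 h₂)
  refine (pow_left_inj₀ zero_le zero_le hmn.ne').1 ?_
  rw [← map_pow v (ι d), ← map_pow ι, hd, hι, ← h, ← hzφ, pow_mul, map_pow]

/-- Let `W` be a residually algebraic torsion extension of `ℤ_p` to `ℚ_p(X)`.
Then there exists a pseudo-convergent sequence `E = {s_n} ⊆ Q̄_p` of transcendental type such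
that `W = ℤ_{p,E} = {φ ∈ ℚ_p(X) : φ(s_n) ∈ Z̄_p for all sufficiently large n}`. -/
theorem stmt_2 (p : ℕ) [Fact p.Prime] (S : PadicSetup p)
    (W : ValuationSubring (RatFunc ℚ_[p])) (hW : IsResAlgTorsionQp p W) :
    ∃ s : ℕ → Qpbar p, S.vbar.IsPseudoConvergent s ∧ S.vbar.IsTranscendentalType s ∧
      (W : Set (RatFunc ℚ_[p])) = ZpE p S s := by
  let Ω := AlgebraicClosure (RatFunc ℚ_[p])
  obtain ⟨B, hB, hres⟩ := exists_extension_of_isResAlgTorsionQp hW (Ω := Ω)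
  let ι₀ : Qpbar p →ₐ[ℚ_[p]] Ω := IsAlgClosed.lift
  let ι : Qpbar p →+* Ω := ι₀
  have hι : ∀ c, ι (algebraMap ℚ_[p] (Qpbar p) c) =
      algebraMap (RatFunc ℚ_[p]) Ω (RatFunc.C c) := fun c =>
    (ι₀.commutes c).trans (IsScalarTower.algebraMap_apply ℚ_[p] (RatFunc ℚ_[p]) Ω c)
  have hle := S.vbar_le_iff (v := B.valuation) (ι := ι) fun c => by rw [hι, hB, hW.1]
  let x : Ω := algebraMap (RatFunc ℚ_[p]) Ω RatFunc.X
  have heval : ∀ f : ℚ_[p][X], (f.map (algebraMap ℚ_[p] (Qpbar p))).eval₂ ι x =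
      algebraMap (RatFunc ℚ_[p]) Ω (algebraMap ℚ_[p][X] (RatFunc ℚ_[p]) f) := by
    intro f
    rw [eval₂_map]
    refine congrFun (congrArg DFunLike.coe (show eval₂RingHom _ x =
      (algebraMap (RatFunc ℚ_[p]) Ω).comp (algebraMap ℚ_[p][X] (RatFunc ℚ_[p])) from ringHom_ext (fun c => ?_) ?_)) f
    · simpa using hι c
    · simp [x]
  have hx : ∀ a, ∃ b, B.valuation (x - ι b) < B.valuation (x - ι a) := by
    intro a
    have hxa : x - ι a ≠ 0 := by
      intro h
      obtain ⟨f, hf0, hf⟩ := Algebra.IsAlgebraic.isAlgebraic (R := ℚ_[p]) a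
      have h0 := heval f
      rw [sub_eq_zero.1 h, eval₂_at_apply, eval_map_algebraMap, hf, map_zero] at h0
      have h0' := ((map_eq_zero _).1 h0.symm)
      exact hf0 ((map_eq_zero_iff _ (RatFunc.algebraMap_injective _)).1 h0')
    obtain ⟨c, hc⟩ := exists_valuation_eq_of_isResAlgTorsionQp hW hB hι (x - ι a)
    have hxa' : B.valuation (x - ι a) ≠ 0 := B.valuation.ne_zero_iff.2 hxa
    have hιc : ι c ≠ 0 := B.valuation.ne_zero_iff.1 (hc ▸ hxa')
    have hz : (x - ι a) / ι c ∈ B := by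
      rw [← B.valuation_le_one_iff, map_div₀, ← hc, div_self hxa']
    obtain ⟨d, hd⟩ := ValuationSubring.exists_valuation_sub_lt_one ι (hres ⟨_, hz⟩)
    refine ⟨a + c * d, ?_⟩
    rw [show x - ι (a + c * d) = ((x - ι a) / ι c - ι d) * ι c by
      rw [map_add, map_mul, sub_mul, div_mul_cancel₀ _ hιc]; ring, map_mul, ← hc]
    exact mul_lt_of_lt_one_left (zero_lt_iff.2 hxa') hd
  obtain ⟨s, hs, hs'⟩ := exists_seq_strictAnti_approx S.vbar ι B.valuation hle x hx
  have hev := eventually_valuation_eval_eq (ι := ι) (v := B.valuation) hs'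
  refine ⟨s, isPseudoConvergent_of_strictAnti hle hs, fun f => ?_, ?_⟩
  · obtain ⟨N, hN⟩ := eventually_atTop.1 (hev f)
    refine ⟨N, fun m hm n hn => ?_⟩
    have h := (hN m hm).trans (hN n hn).symm
    exact le_antisymm ((hle _ _).2 h.ge) ((hle _ _).2 h.le)
  · ext φ
    have hmem : ∀ᶠ n in atTop, φ.denom.eval₂ (algebraMap ℚ_[p] (Qpbar p)) (s n) ≠ 0 ∧
        (0 ≤ S.vbar.v (φ.eval (algebraMap ℚ_[p] (Qpbar p)) (s n)) ↔ φ ∈ W) := by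
      have hden : algebraMap (RatFunc ℚ_[p]) Ω
          (algebraMap ℚ_[p][X] (RatFunc ℚ_[p]) φ.denom) ≠ 0 := by
        simpa using φ.denom_ne_zero
      filter_upwards [hev (φ.denom.map (algebraMap ℚ_[p] (Qpbar p))),
        hev (φ.num.map (algebraMap ℚ_[p] (Qpbar p)))] with n h₁ h₂
      rw [heval, eval_map] at h₁ h₂
      have h0 : φ.denom.eval₂ (algebraMap ℚ_[p] (Qpbar p)) (s n) ≠ 0 := by
        intro h
        rw [h, map_zero, map_zero] at h₁
        exact hden (B.valuation.zero_iff.1 h₁.symm)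
      refine ⟨h0, ?_⟩
      rw [RatFunc.eval, S.vbar.zero_le_v_div_iff h0, hle, h₁, h₂, ← hB]
      conv_rhs => rw [← φ.num_div_denom, map_div₀, map_div₀]
      rw [div_le_one₀ (zero_lt_iff.2 (B.valuation.ne_zero_iff.2 hden))]
    refine ⟨fun h => hmem.mono fun n hn => ⟨hn.1, hn.2.2 h⟩, fun h => ?_⟩
    obtain ⟨n, hn, hn'⟩ := (hmem.and h).exists
    exact hn.2.1 hn'.2

end
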